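/- Let μ, μ′, ν, ν′ ∈ M satisfy μ ≤_{C,+} ν, μ′ ≤_{C,+} ν′, μ(ℝ) = μ′(ℝ) and ν(ℝ) = ν′(ℝ). Then W(S^ν(μ), S^{ν′}(μ′)) ≤ W(μ, μ′) + 2 W(ν, ν′). -/

import Mathlib

open MeasureTheory Set Filter ProbabilityTheory

noncomputable section

/-- A function has at most linear growth. -/
def LinGrowth (φ : ℝ → ℝ) : Prop := ∃ C : ℝ, ∀ x : ℝ, |φ x| ≤ C * (1 + |x|)

/-- Membership in `M`: finite positive Borel measure on `ℝ` with finite first moment. -/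
def MemM (μ : Measure ℝ) : Prop := IsFiniteMeasure μ ∧ Integrable (fun x => x) μ

/-- Stochastic order `≤_sto`. -/
def leSto (μ ν : Measure ℝ) : Prop :=
  ∀ φ : ℝ → ℝ, LinGrowth φ → Monotone φ → ∫ x, φ x ∂μ ≤ ∫ x, φ x ∂ν

/-- Convex order `≤_C`. -/
def leC (μ ν : Measure ℝ) : Prop :=
  ∀ φ : ℝ → ℝ, LinGrowth φ → ConvexOn ℝ Set.univ φ → ∫ x, φ x ∂μ ≤ ∫ x, φ x ∂ν

/-- Order `≤_{C,+}` (extended order). -/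
def leCP (μ ν : Measure ℝ) : Prop :=
  ∀ φ : ℝ → ℝ, LinGrowth φ → ConvexOn ℝ Set.univ φ → (∀ x, 0 ≤ φ x) →
    ∫ x, φ x ∂μ ≤ ∫ x, φ x ∂ν

/-- Order `≤_{sto,+}`. -/
def leStoP (μ ν : Measure ℝ) : Prop :=
  ∀ φ : ℝ → ℝ, LinGrowth φ → Monotone φ → (∀ x, 0 ≤ φ x) →
    ∫ x, φ x ∂μ ≤ ∫ x, φ x ∂ν

/-- Order `≤_{C,sto}`. -/
def leCS (μ ν : Measure ℝ) : Prop :=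
  ∀ φ : ℝ → ℝ, LinGrowth φ → ConvexOn ℝ Set.univ φ → Monotone φ →
    ∫ x, φ x ∂μ ≤ ∫ x, φ x ∂ν

/-- Order `≤_{C,+,sto}`. -/
def leCPS (μ ν : Measure ℝ) : Prop :=
  ∀ φ : ℝ → ℝ, LinGrowth φ → ConvexOn ℝ Set.univ φ → (∀ x, 0 ≤ φ x) → Monotone φ →
    ∫ x, φ x ∂μ ≤ ∫ x, φ x ∂ν

/-- The Kantorovich distance. -/
def W (μ ν : Measure ℝ) : ℝ :=
  sSup {d : ℝ | ∃ f : ℝ → ℝ, LipschitzWith 1 f ∧ d = |∫ x, f x ∂μ - ∫ x, f x ∂ν|}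

/-- Quantile function `G_ν`. -/
def quantile (ν : Measure ℝ) (t : ℝ) : ℝ := sInf {x : ℝ | t ≤ (ν (Set.Iic x)).toReal}

/-- `IsShadow μ ν η` means `η = S^ν(μ)`, the shadow of `μ` in `ν`. -/
def IsShadow (μ ν η : Measure ℝ) : Prop :=
  leC μ η ∧ η ≤ ν ∧ ∀ η' : Measure ℝ, leC μ η' → η' ≤ ν → leC η η'

/-- `Top(μ,ν)`: pushforward of Lebesgue measure on `(0, m]` by `max (G_μ) (G_ν)`. -/
def TopMeas (μ ν : Measure ℝ) : Measure ℝ :=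
  Measure.map (fun t => max (quantile μ t) (quantile ν t))
    (volume.restrict (Set.Ioc (0:ℝ) (μ Set.univ).toReal))

/-- `Down(μ,ν)`: pushforward of Lebesgue measure on `(0, m]` by `min (G_μ) (G_ν)`. -/
def DownMeas (μ ν : Measure ℝ) : Measure ℝ :=
  Measure.map (fun t => min (quantile μ t) (quantile ν t))
    (volume.restrict (Set.Ioc (0:ℝ) (μ Set.univ).toReal))

/-- Support of a measure on a topological space. -/
def mSupport {α : Type*} [TopologicalSpace α] [MeasurableSpace α] (μ : Measure α) : Set α :=
  {x | ∀ U ∈ nhds x, μ U ≠ 0}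

/-- Positive part (Jordan decomposition) of the signed measure `η - μ`. -/
def posPartSub (η μ : Measure ℝ) [IsFiniteMeasure η] [IsFiniteMeasure μ] : Measure ℝ :=
  (η.toSignedMeasure - μ.toSignedMeasure).toJordanDecomposition.posPart

/-- `π` is a martingale coupling of `μ` and `ν`. -/
def IsMartCoupling (π : Measure (ℝ × ℝ)) (μ ν : Measure ℝ) : Prop :=
  IsProbabilityMeasure π ∧ π.fst = μ ∧ π.snd = ν ∧
    ∀ f : ℝ → ℝ, Continuous f → (∃ C : ℝ, ∀ x, |f x| ≤ C) →
      ∫ p : ℝ × ℝ, f p.1 * (p.2 - p.1) ∂π = 0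

/-- A coupling is left-monotone. -/
def LeftMonotone (π : Measure (ℝ × ℝ)) : Prop :=
  ∃ Γ : Set (ℝ × ℝ), MeasurableSet Γ ∧ π Γ = 1 ∧
    ∀ x ym yp x' y' : ℝ, (x, ym) ∈ Γ → (x, yp) ∈ Γ → (x', y') ∈ Γ →
      x < x' → ym < yp → y' ∉ Set.Ioo ym yp

/-- The set `A` of points `x` with `π((-∞,x) × (x,∞)) = 0`. -/
def jumpSet (π : Measure (ℝ × ℝ)) : Set ℝ := {x | π (Set.Iio x ×ˢ Set.Ioi x) = 0}

/-- The set `A⁻` of points of `A` isolated on the right in `A`. -/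
def jumpSetMinus (π : Measure (ℝ × ℝ)) : Set ℝ :=
  {x ∈ jumpSet π | ∃ ε > 0, Set.Ioo x (x + ε) ∩ jumpSet π = ∅}

/-- Normalised fiber measure `π_x`. -/
def fiberMeasure (π : Measure (ℝ × ℝ)) (x : ℝ) : Measure ℝ :=
  (π.fst {x})⁻¹ • Measure.snd (π.restrict ({x} ×ˢ Set.univ))

/-- The reduced support `spt* π`. -/
def sptStar (π : Measure (ℝ × ℝ)) : Set (ℝ × ℝ) :=
  (mSupport π \ (jumpSetMinus π ×ˢ (Set.univ : Set ℝ))) ∪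
    ⋃ x ∈ {x : ℝ | 0 < π.fst {x}}, {x} ×ˢ mSupport (fiberMeasure π x)

/-! ### Hinge potentials -/

/-- The potential `x ↦ ∫ (x - y)⁺ dμ(y)` of a measure on the line. -/
def pot (μ : Measure ℝ) (x : ℝ) : ℝ := ∫ y, max (x - y) 0 ∂μ

lemma MemM.integrable {μ : Measure ℝ} (hμ : MemM μ) {f : ℝ → ℝ} (hf : Continuous f)
    (hg : LinGrowth f) : Integrable f μ := by
  have := hμ.1
  obtain ⟨C, hC⟩ := hg
  refine Integrable.mono' (g := fun x => C * (1 + |x|)) ?_ hf.aestronglyMeasurable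
    (ae_of_all _ hC)
  exact ((integrable_const 1).add hμ.2.abs).const_mul C

lemma MemM.of_le {η ν : Measure ℝ} (hν : MemM ν) (h : η ≤ ν) : MemM η :=
  ⟨have := hν.1; isFiniteMeasure_of_le ν h, hν.2.mono_measure h⟩

lemma linGrowth_of_lipschitz {f : ℝ → ℝ} {L : ℝ} (hL : ∀ a b, |f a - f b| ≤ L * |a - b|) :
    LinGrowth f := by
  refine ⟨|f 0| + L, fun x => ?_⟩
  have h := hL x 0
  have h0 := hL 1 0
  have h1 : |f x| ≤ |f x - f 0| + |f 0| := by simpa using abs_add_le (f x - f 0) (f 0)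
  simp only [sub_zero, abs_one, mul_one] at h h0
  have h2 := abs_nonneg (f 1 - f 0)
  nlinarith [abs_nonneg x, abs_nonneg (f 0)]

lemma continuous_of_lipschitz {f : ℝ → ℝ} {L : ℝ} (hL : ∀ a b, |f a - f b| ≤ L * |a - b|) :
    Continuous f :=
  (LipschitzWith.of_dist_le_mul (K := L.toNNReal) fun a b => by
    rw [Real.dist_eq, Real.dist_eq]
    exact (hL a b).trans (mul_le_mul_of_nonneg_right (Real.le_coe_toNNReal L)
      (abs_nonneg _))).continuous

lemma hinge_lipschitz (x a b : ℝ) : |max (x - a) 0 - max (x - b) 0| ≤ 1 * |a - b| := by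
  have := abs_max_sub_max_le_abs (x - a) (x - b) 0
  rw [one_mul, abs_sub_comm a b]
  simpa using this

lemma hinge_lipschitz' (x a b : ℝ) : |max (a - x) 0 - max (b - x) 0| ≤ 1 * |a - b| := by
  have := abs_max_sub_max_le_abs (a - x) (b - x) 0
  rw [one_mul]
  simpa using this

lemma MemM.integrable_hinge {μ : Measure ℝ} (hμ : MemM μ) (x : ℝ) :
    Integrable (fun y => max (x - y) 0) μ :=
  hμ.integrable (by fun_prop) (linGrowth_of_lipschitz (hinge_lipschitz x))

lemma MemM.integrable_hinge' {μ : Measure ℝ} (hμ : MemM μ) (x : ℝ) :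
    Integrable (fun y => max (y - x) 0) μ :=
  hμ.integrable (by fun_prop) (linGrowth_of_lipschitz (hinge_lipschitz' x))

lemma convexOn_hinge' (y : ℝ) : ConvexOn ℝ univ (fun x : ℝ => max (x - y) 0) :=
  ((convexOn_id convex_univ).sub (concaveOn_const y convex_univ)).sup
    (convexOn_const 0 convex_univ)

lemma convexOn_hinge (x : ℝ) : ConvexOn ℝ univ (fun y : ℝ => max (x - y) 0) :=
  ((convexOn_const x convex_univ).sub (concaveOn_id convex_univ)).sup
    (convexOn_const 0 convex_univ)

lemma pot_convexOn {μ : Measure ℝ} (hμ : MemM μ) : ConvexOn ℝ univ (pot μ) := by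
  refine ⟨convex_univ, fun x _ y _ a b ha hb hab => ?_⟩
  simp only [pot, smul_eq_mul]
  rw [← integral_const_mul, ← integral_const_mul,
    ← integral_add ((hμ.integrable_hinge x).const_mul a) ((hμ.integrable_hinge y).const_mul b)]
  refine integral_mono (hμ.integrable_hinge _)
    (((hμ.integrable_hinge x).const_mul a).add ((hμ.integrable_hinge y).const_mul b)) fun z => ?_
  exact (convexOn_hinge' z).2 trivial trivial ha hb hab

lemma continuous_of_convexOn {f : ℝ → ℝ} (hf : ConvexOn ℝ univ f) : Continuous f :=
  continuousOn_univ.1 (hf.continuousOn isOpen_univ)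

lemma pot_add {μ ν : Measure ℝ} (hμ : MemM μ) (hν : MemM ν) (x : ℝ) :
    pot (μ + ν) x = pot μ x + pot ν x :=
  integral_add_measure (hμ.integrable_hinge x) (hν.integrable_hinge x)

lemma pot_tendsto_atBot {μ : Measure ℝ} (hμ : MemM μ) : Tendsto (pot μ) atBot (nhds 0) := by
  have : Tendsto (pot μ) atBot (nhds (∫ _, (0 : ℝ) ∂μ)) := by
    refine tendsto_integral_filter_of_dominated_convergence (fun y => |max (0 - y) 0|) ?_ ?_
      (hμ.integrable_hinge 0).abs ?_
    · exact Eventually.of_forall fun x => (hμ.integrable_hinge x).aestronglyMeasurable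
    · filter_upwards [eventually_le_atBot 0] with x hx
      refine ae_of_all _ fun y => ?_
      rw [Real.norm_eq_abs]
      refine abs_le_abs_of_nonneg (le_max_right _ _) (max_le_max (by linarith) le_rfl)
    · refine ae_of_all _ fun y => tendsto_const_nhds.congr' ?_
      filter_upwards [eventually_le_atBot y] with x hx
      exact (max_eq_right (by linarith)).symm
  simpa using this

lemma pot_sub_tendsto_atTop {μ : Measure ℝ} (hμ : MemM μ) :
    Tendsto (fun x => pot μ x - (μ.real univ * x - ∫ y, y ∂μ)) atTop (nhds 0) := by
  have := hμ.1
  have : Tendsto (fun x => ∫ y, max (y - x) 0 ∂μ) atTop (nhds (∫ _, (0 : ℝ) ∂μ)) := by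
    refine tendsto_integral_filter_of_dominated_convergence (fun y => |max (y - 0) 0|) ?_ ?_
      (hμ.integrable_hinge' 0).abs ?_
    · exact Eventually.of_forall fun x => (hμ.integrable_hinge' x).aestronglyMeasurable
    · filter_upwards [eventually_ge_atTop 0] with x hx
      refine ae_of_all _ fun y => ?_
      rw [Real.norm_eq_abs]
      refine abs_le_abs_of_nonneg (le_max_right _ _) (max_le_max (by linarith) le_rfl)
    · refine ae_of_all _ fun y => tendsto_const_nhds.congr' ?_
      filter_upwards [eventually_ge_atTop y] with x hx
      exact (max_eq_right (by linarith)).symm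
  rw [integral_zero] at this
  refine this.congr fun x => ?_
  have h1 : ∫ y, (x - y) ∂μ = μ.real univ * x - ∫ y, y ∂μ := by
    rw [integral_sub (integrable_const x) hμ.2]; simp
  rw [pot, ← h1, ← integral_sub (hμ.integrable_hinge x)
    (show Integrable (fun y => x - y) μ from (integrable_const x).sub hμ.2)]
  refine integral_congr_ae (ae_of_all _ fun y => ?_)
  change max (y - x) 0 = max (x - y) 0 - (x - y)
  rcases le_total x y with h | h
  · rw [max_eq_left (by linarith), max_eq_right (by linarith)]; ring
  · rw [max_eq_right (by linarith), max_eq_left (by linarith)]; ring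

/-! ### Piecewise linear interpolation -/

/-- The piecewise linear function equal to `1` left of `a` and to `0` right of `b`. -/
def ramp (a b y : ℝ) : ℝ := (max (b - y) 0 - max (a - y) 0) / (b - a)

lemma ramp_of_le {a b y : ℝ} (hab : a < b) (h : y ≤ a) : ramp a b y = 1 := by
  rw [ramp, max_eq_left (by linarith), max_eq_left (by linarith), sub_sub_sub_cancel_right,
    div_self (by linarith)]

lemma ramp_of_ge {a b y : ℝ} (hab : a < b) (h : b ≤ y) : ramp a b y = 0 := by
  rw [ramp, max_eq_right (by linarith), max_eq_right (by linarith)]; simp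

lemma ramp_mem {a b : ℝ} (hab : a < b) (y : ℝ) : 0 ≤ ramp a b y ∧ ramp a b y ≤ 1 := by
  have h : 0 < b - a := by linarith
  constructor
  · exact div_nonneg (sub_nonneg.2 (max_le_max (by linarith) le_rfl)) h.le
  · rw [ramp, div_le_one h, sub_le_iff_le_add]
    refine max_le ?_ ?_
    · linarith [le_max_left (a - y) 0]
    · linarith [le_max_right (a - y) 0]

lemma integral_ramp {μ : Measure ℝ} (hμ : MemM μ) (a b : ℝ) :
    ∫ y, ramp a b y ∂μ = (pot μ b - pot μ a) / (b - a) := by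
  simp only [ramp, pot]
  rw [integral_div, integral_sub (hμ.integrable_hinge b) (hμ.integrable_hinge a)]

lemma integrable_ramp {μ : Measure ℝ} (hμ : MemM μ) (a b : ℝ) : Integrable (ramp a b) μ :=
  ((hμ.integrable_hinge b).sub (hμ.integrable_hinge a)).div_const _

/-- Piecewise linear interpolation of `f` at `x 0, …, x N`, constant outside. -/
def interp (f : ℝ → ℝ) (x : ℕ → ℝ) (N : ℕ) (y : ℝ) : ℝ :=
  f (x 0) + ∑ i ∈ Finset.range N, (f (x (i + 1)) - f (x i)) * (1 - ramp (x i) (x (i + 1)) y)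

lemma interp_of_ge (f : ℝ → ℝ) {x : ℕ → ℝ} (hx : StrictMono x) {N : ℕ} {y : ℝ}
    (hy : x N ≤ y) : interp f x N y = f (x N) := by
  have : ∀ i ∈ Finset.range N, (f (x (i + 1)) - f (x i)) * (1 - ramp (x i) (x (i + 1)) y)
      = f (x (i + 1)) - f (x i) := fun i hi => by
    rw [ramp_of_ge (hx (Nat.lt_succ_self i)), sub_zero, mul_one]
    exact (hx.monotone (Nat.succ_le_of_lt (Finset.mem_range.1 hi))).trans hy
  rw [interp, Finset.sum_congr rfl this, Finset.sum_range_sub (fun i => f (x i))]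
  ring

lemma interp_close {f : ℝ → ℝ} {L δ : ℝ} (hL : ∀ a b, |f a - f b| ≤ L * |a - b|)
    {x : ℕ → ℝ} (hx : StrictMono x) (hδ : ∀ i, x (i + 1) - x i ≤ δ) (N : ℕ) (y : ℝ) :
    |interp f x N y - f (max (x 0) (min y (x N)))| ≤ 2 * (L * δ) := by
  have hL0 : 0 ≤ L := by
    have := (abs_nonneg _).trans (hL 1 0)
    simpa using this
  have hδ0 : 0 ≤ δ := (sub_nonneg.2 (hx (Nat.lt_succ_self 0)).le).trans (hδ 0)
  induction N with
  | zero =>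
    have : max (x 0) (min y (x 0)) = x 0 := max_eq_left (min_le_right _ _)
    rw [this]
    simp [interp]
    positivity
  | succ N ih =>
    have hlt := hx (Nat.lt_succ_self N)
    have h0N : x 0 ≤ x N := hx.monotone (Nat.zero_le N)
    have hs : interp f x (N + 1) y = interp f x N y +
        (f (x (N + 1)) - f (x N)) * (1 - ramp (x N) (x (N + 1)) y) := by
      simp only [interp, Finset.sum_range_succ, add_assoc]
    rcases le_total y (x N) with h | h
    · rw [hs, ramp_of_le hlt h, sub_self, mul_zero, add_zero, min_eq_left (h.trans hlt.le)]
      rwa [min_eq_left h] at ih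
    · rw [hs, interp_of_ge f hx h]
      have h1 : x N ≤ min y (x (N + 1)) := le_min h hlt.le
      rw [max_eq_right (h0N.trans h1)]
      have h2 : min y (x (N + 1)) ≤ x (N + 1) := min_le_right _ _
      have h3 := hL (x (N + 1)) (x N)
      have h4 := hL (x N) (min y (x (N + 1)))
      rw [abs_of_pos (sub_pos.2 hlt)] at h3
      rw [abs_of_nonpos (sub_nonpos.2 h1)] at h4
      have h5 : L * (x (N + 1) - x N) ≤ L * δ := mul_le_mul_of_nonneg_left (hδ N) hL0
      have h6 : L * -(x N - min y (x (N + 1))) ≤ L * δ :=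
        mul_le_mul_of_nonneg_left (by linarith [hδ N]) hL0
      have h7 := ramp_mem hlt y
      have h8 : |(f (x (N + 1)) - f (x N)) * (1 - ramp (x N) (x (N + 1)) y)| ≤ L * δ := by
        rw [abs_mul, abs_of_nonneg (sub_nonneg.2 h7.2)]
        nlinarith [abs_nonneg (f (x (N + 1)) - f (x N))]
      calc _ = |(f (x N) - f (min y (x (N + 1)))) +
              (f (x (N + 1)) - f (x N)) * (1 - ramp (x N) (x (N + 1)) y)| := by ring_nf
        _ ≤ _ := abs_add_le _ _
        _ ≤ 2 * (L * δ) := by linarith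

lemma integrable_interp {μ : Measure ℝ} (hμ : MemM μ) (f : ℝ → ℝ) (x : ℕ → ℝ) (N : ℕ) :
    Integrable (interp f x N) μ := by
  have := hμ.1
  exact (integrable_const _).add (integrable_finsetSum _ fun i _ =>
    ((integrable_const 1).sub (integrable_ramp hμ _ _)).const_mul _)

lemma integral_interp {μ : Measure ℝ} (hμ : MemM μ) (f : ℝ → ℝ) (x : ℕ → ℝ) (N : ℕ) :
    ∫ y, interp f x N y ∂μ = μ.real univ * f (x 0) +
      ∑ i ∈ Finset.range N, (f (x (i + 1)) - f (x i)) *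
        (μ.real univ - (pot μ (x (i + 1)) - pot μ (x i)) / (x (i + 1) - x i)) := by
  have := hμ.1
  have hi : ∀ i ∈ Finset.range N, Integrable
      (fun y => (f (x (i + 1)) - f (x i)) * (1 - ramp (x i) (x (i + 1)) y)) μ := fun i _ =>
    ((integrable_const 1).sub (integrable_ramp hμ _ _)).const_mul _
  simp only [interp]
  rw [integral_add (integrable_const _) (integrable_finsetSum _ hi), integral_finsetSum _ hi]
  congr 1
  · simp
  · refine Finset.sum_congr rfl fun i _ => ?_
    rw [integral_const_mul, integral_sub (integrable_const 1) (integrable_ramp hμ _ _),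
      integral_ramp hμ]
    simp

lemma integral_interp_sub {α β : Measure ℝ} (hα : MemM α) (hβ : MemM β)
    (hm : α.real univ = β.real univ) (f : ℝ → ℝ) (x : ℕ → ℝ) (N : ℕ) :
    ∫ y, interp f x N y ∂α - ∫ y, interp f x N y ∂β =
      -∑ i ∈ Finset.range N, (f (x (i + 1)) - f (x i)) / (x (i + 1) - x i) *
        ((pot α (x (i + 1)) - pot β (x (i + 1))) - (pot α (x i) - pot β (x i))) := by
  rw [integral_interp hα, integral_interp hβ, hm, add_sub_add_left_eq_sub,
    ← Finset.sum_sub_distrib, ← Finset.sum_neg_distrib]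
  refine Finset.sum_congr rfl fun i _ => ?_
  ring

/-- The grid of mesh `1 / (n + 1)` starting at `-(n + 1)`. -/
def grid (n i : ℕ) : ℝ := -(n + 1 : ℝ) + i / (n + 1 : ℝ)

/-- The index at which `grid n` reaches `n + 1`, minus one. -/
def gridLen (n : ℕ) : ℕ := 2 * n * n + 4 * n + 1

lemma grid_zero (n : ℕ) : grid n 0 = -(n + 1 : ℝ) := by simp [grid]

lemma grid_gridLen (n : ℕ) : grid n (gridLen n + 1) = n + 1 := by
  have : (n + 1 : ℝ) ≠ 0 := by positivity
  simp only [grid, gridLen]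
  push_cast
  field_simp
  ring

lemma grid_succ_sub (n i : ℕ) : grid n (i + 1) - grid n i = 1 / (n + 1 : ℝ) := by
  simp only [grid]
  push_cast
  ring

lemma grid_strictMono (n : ℕ) : StrictMono (grid n) :=
  strictMono_nat_of_lt_succ fun i => by
    have : (0 : ℝ) < 1 / (n + 1 : ℝ) := by positivity
    linarith [grid_succ_sub n i]

lemma tendsto_integral_interp {μ : Measure ℝ} (hμ : MemM μ) {f : ℝ → ℝ} {L : ℝ}
    (hL : ∀ a b, |f a - f b| ≤ L * |a - b|) :
    Tendsto (fun n => ∫ y, interp f (grid n) (gridLen n + 1) y ∂μ) atTop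
      (nhds (∫ y, f y ∂μ)) := by
  have := hμ.1
  have hL0 : 0 ≤ L := by
    have := (abs_nonneg _).trans (hL 1 0)
    simpa using this
  have hc := fun n y => interp_close hL (grid_strictMono n)
    (fun i => (grid_succ_sub n i).le) (gridLen n + 1) y
  simp only [grid_zero, grid_gridLen] at hc
  refine tendsto_integral_of_dominated_convergence (fun y => (|f 0| + 2 * L) + L * |y|)
    (fun n => (integrable_interp hμ f _ _).aestronglyMeasurable)
    ((integrable_const _).add (hμ.2.abs.const_mul L)) (fun n => ae_of_all _ fun y => ?_)
    (ae_of_all _ fun y => ?_)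
  · have h1 := hc n y
    set z := max (-(n + 1 : ℝ)) (min y (n + 1)) with hz
    have hzy : |z| ≤ |y| := by
      have hn : (0 : ℝ) ≤ n := Nat.cast_nonneg n
      rw [abs_le, hz]
      constructor
      · refine le_max_of_le_right (le_min (neg_abs_le y) ?_)
        linarith [abs_nonneg y]
      · refine max_le (by linarith [abs_nonneg y]) ((min_le_left _ _).trans (le_abs_self y))
    have h2 := hL z 0
    rw [sub_zero] at h2
    have h3 : 1 / (n + 1 : ℝ) ≤ 1 := by
      rw [div_le_one (by positivity)]; linarith [Nat.cast_nonneg (α := ℝ) n]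
    have h4 : L * (1 / (n + 1 : ℝ)) ≤ L * 1 := mul_le_mul_of_nonneg_left h3 hL0
    have h5 : L * |z| ≤ L * |y| := mul_le_mul_of_nonneg_left hzy hL0
    rw [Real.norm_eq_abs, abs_le]
    have h6 := abs_le.1 h1
    have h7 := abs_le.1 h2
    have h8 := neg_abs_le (f 0)
    have h9 := le_abs_self (f 0)
    constructor <;> linarith [h6.1, h6.2, h7.1, h7.2]
  · rw [tendsto_iff_dist_tendsto_zero]
    have h0 : Tendsto (fun n : ℕ => 2 * (L * (1 / (n + 1 : ℝ)))) atTop (nhds 0) := by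
      simpa using (tendsto_one_div_add_atTop_nhds_zero_nat (𝕜 := ℝ)).const_mul L |>.const_mul 2
    refine squeeze_zero' (Eventually.of_forall fun n => dist_nonneg) ?_ h0
    filter_upwards [eventually_ge_atTop ⌈|y|⌉₊] with n hn
    have hn' : |y| ≤ n := (Nat.le_ceil _).trans (by exact_mod_cast hn)
    have h1 := abs_le.1 hn'
    have h2 := hc n y
    rwa [min_eq_left (by linarith), max_eq_right (by linarith)] at h2

/-! ### Convex order and potentials -/

lemma ConvexOn.sub_le_of_linGrowth {f : ℝ → ℝ} (hf : ConvexOn ℝ univ f) {C : ℝ}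
    (hC : ∀ x, |f x| ≤ C * (1 + |x|)) {x y : ℝ} (hxy : x < y) : f y - f x ≤ C * (y - x) := by
  rw [← div_le_iff₀ (sub_pos.2 hxy)]
  set s := (f y - f x) / (y - x) with hs
  by_contra! h
  obtain ⟨z, hz⟩ := exists_gt (max (max y 0) ((C + |f y| + s * y) / (s - C)))
  obtain ⟨⟨hzy, hz0⟩, hz1⟩ : (y < z ∧ 0 < z) ∧ (C + |f y| + s * y) / (s - C) < z := by
    simpa only [max_lt_iff] using hz
  have h1 := hf.slope_mono_adjacent (mem_univ x) (mem_univ z) hxy hzy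
  rw [← hs, le_div_iff₀ (sub_pos.2 hzy)] at h1
  rw [div_lt_iff₀ (sub_pos.2 h)] at hz1
  have h2 := hC z
  rw [abs_of_pos hz0] at h2
  have h3 := le_abs_self (f z)
  have h4 := neg_abs_le (f y)
  nlinarith

lemma ConvexOn.lipschitz_of_linGrowth {f : ℝ → ℝ} (hf : ConvexOn ℝ univ f) {C : ℝ}
    (hC : ∀ x, |f x| ≤ C * (1 + |x|)) (x y : ℝ) : |f x - f y| ≤ C * |x - y| := by
  have hneg : ConvexOn ℝ univ (fun x => f (-x)) := by
    refine ⟨convex_univ, fun x _ y _ a b ha hb hab => ?_⟩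
    have := hf.2 (mem_univ (-x)) (mem_univ (-y)) ha hb hab
    convert this using 2
    simp only [smul_eq_mul]; ring
  have key : ∀ x y : ℝ, x < y → |f x - f y| ≤ C * |x - y| := fun x y hxy => by
    have h1 := hf.sub_le_of_linGrowth hC hxy
    have h2 := hneg.sub_le_of_linGrowth (C := C) (fun x => by simpa using hC (-x))
      (neg_lt_neg hxy)
    simp only [neg_neg] at h2
    rw [abs_sub_comm x y, abs_of_pos (sub_pos.2 hxy), abs_le]
    constructor <;> linarith
  rcases lt_trichotomy x y with h | h | h
  · exact key x y h
  · simp [h]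
  · rw [abs_sub_comm, abs_sub_comm x y]; exact key y x h

lemma linGrowth_id : LinGrowth fun x => x := ⟨1, fun x => by linarith⟩

lemma leC.measureReal_eq {μ η : Measure ℝ} (h : leC μ η) : μ.real univ = η.real univ := by
  refine le_antisymm ?_ ?_
  · simpa using h (fun _ => 1) ⟨1, fun x => by simp⟩ (convexOn_const 1 convex_univ)
  · simpa using h (fun _ => -1) ⟨1, fun x => by simp⟩ (convexOn_const (-1) convex_univ)

lemma leC.integral_id_eq {μ η : Measure ℝ} (h : leC μ η) : ∫ y, y ∂μ = ∫ y, y ∂η := by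
  refine le_antisymm (h (fun y => y) linGrowth_id (convexOn_id convex_univ)) ?_
  have := h (fun y => -y) ⟨1, fun x => by simp⟩ (concaveOn_id convex_univ).neg
  rwa [integral_neg, integral_neg, neg_le_neg_iff] at this

lemma leC.pot_le {μ η : Measure ℝ} (h : leC μ η) (x : ℝ) : pot μ x ≤ pot η x :=
  h _ (linGrowth_of_lipschitz (hinge_lipschitz x)) (convexOn_hinge x)

lemma pot_sub_pot_tendsto_atBot {α β : Measure ℝ} (hα : MemM α) (hβ : MemM β) :
    Tendsto (fun x => pot α x - pot β x) atBot (nhds 0) := by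
  simpa using (pot_tendsto_atBot hα).sub (pot_tendsto_atBot hβ)

lemma pot_sub_pot_tendsto_atTop {α β : Measure ℝ} (hα : MemM α) (hβ : MemM β)
    (hm : α.real univ = β.real univ) (hb : ∫ y, y ∂α = ∫ y, y ∂β) :
    Tendsto (fun x => pot α x - pot β x) atTop (nhds 0) := by
  have := (pot_sub_tendsto_atTop hα).sub (pot_sub_tendsto_atTop hβ)
  rw [sub_zero] at this
  refine this.congr fun x => ?_
  rw [hm, hb]; ring

lemma tendsto_nat_add_one_atTop : Tendsto (fun n : ℕ => (n + 1 : ℝ)) atTop atTop :=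
  tendsto_atTop_add_const_right _ _ tendsto_natCast_atTop_atTop

lemma tendsto_neg_nat_add_one_atBot : Tendsto (fun n : ℕ => -(n + 1 : ℝ)) atTop atBot :=
  tendsto_neg_atTop_atBot.comp tendsto_nat_add_one_atTop

lemma leC_of_pot_le {μ η : Measure ℝ} (hμ : MemM μ) (hη : MemM η)
    (hm : μ.real univ = η.real univ) (hb : ∫ y, y ∂μ = ∫ y, y ∂η)
    (hp : ∀ x, pot μ x ≤ pot η x) : leC μ η := by
  rintro φ ⟨C, hC⟩ hφ
  have hL := hφ.lipschitz_of_linGrowth hC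
  set p : ℝ → ℝ := fun x => pot η x - pot μ x with hpdef
  have hp0 : ∀ x, 0 ≤ p x := fun x => sub_nonneg.2 (hp x)
  have key : ∀ n : ℕ, -(C * p (n + 1) + C * p (-(n + 1 : ℝ))) ≤
      ∫ y, interp φ (grid n) (gridLen n + 1) y ∂η -
        ∫ y, interp φ (grid n) (gridLen n + 1) y ∂μ := fun n => by
    rw [integral_interp_sub hη hμ hm.symm]
    set x := grid n with hx
    have hxm : StrictMono x := grid_strictMono n
    set s : ℕ → ℝ := fun i => (φ (x (i + 1)) - φ (x i)) / (x (i + 1) - x i) with hs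
    have hsm : ∀ i, s i ≤ s (i + 1) := fun i =>
      hφ.slope_mono_adjacent (mem_univ _) (mem_univ _) (hxm (Nat.lt_succ_self i))
        (hxm (Nat.lt_succ_self (i + 1)))
    have hsC : ∀ i, |s i| ≤ C := fun i => by
      have h1 : 0 < x (i + 1) - x i := sub_pos.2 (hxm (Nat.lt_succ_self i))
      have h2 := hL (x (i + 1)) (x i)
      rw [hs, abs_div, div_le_iff₀ (abs_pos.2 h1.ne')]
      exact h2
    have abel : ∀ N : ℕ, -s N * p (x (N + 1)) + s 0 * p (x 0) ≤
        -∑ i ∈ Finset.range (N + 1), s i * (p (x (i + 1)) - p (x i)) := fun N => by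
      induction N with
      | zero => simp; linarith
      | succ N ih =>
        rw [Finset.sum_range_succ]
        nlinarith [hsm N, hp0 (x (N + 1))]
    refine le_trans ?_ (abel (gridLen n))
    rw [hx, grid_zero, grid_gridLen]
    have h1 := abs_le.1 (hsC (gridLen n))
    have h2 := abs_le.1 (hsC 0)
    nlinarith [hp0 (n + 1), hp0 (-(n + 1 : ℝ))]
  have hlim : Tendsto (fun n : ℕ => -(C * p (n + 1) + C * p (-(n + 1 : ℝ)))) atTop (nhds 0) := by
    have h1 := (pot_sub_pot_tendsto_atTop hη hμ hm.symm hb.symm).comp tendsto_nat_add_one_atTop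
    have h2 := (pot_sub_pot_tendsto_atBot hη hμ).comp tendsto_neg_nat_add_one_atBot
    simpa [Function.comp_def, hpdef] using ((h1.const_mul C).add (h2.const_mul C)).neg
  have := le_of_tendsto_of_tendsto' hlim
    ((tendsto_integral_interp hη hL).sub (tendsto_integral_interp hμ hL)) key
  linarith

/-! ### Variation along chains of points -/

/-- The variation of `u` along the chain `a, l, b`. -/
def chainVar (u : ℝ → ℝ) : ℝ → List ℝ → ℝ → ℝ
  | a, [], b => |u b - u a|
  | a, c :: l, b => |u c - u a| + chainVar u c l b

/-- The chain `a, l, b` is nondecreasing. -/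
def MonoChain : ℝ → List ℝ → ℝ → Prop
  | a, [], b => a ≤ b
  | a, c :: l, b => a ≤ c ∧ MonoChain c l b

/-- `u` is midpoint convex around `x` at small scales. -/
def MidConvexAt (u : ℝ → ℝ) (x : ℝ) : Prop :=
  ∃ ε > 0, ∀ t, 0 < t → t < ε → 2 * u x ≤ u (x - t) + u (x + t)

/-- At each point, `u ≤ v` unless `u` is locally midpoint convex, and `v ≤ u` unless `u` is
locally midpoint concave. -/
def Interlaced (u v : ℝ → ℝ) : Prop :=
  ∀ x, (u x ≤ v x ∨ MidConvexAt u x) ∧ (v x ≤ u x ∨ MidConvexAt (fun y => -u y) x)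

lemma Interlaced.neg {u v : ℝ → ℝ} (h : Interlaced u v) :
    Interlaced (fun x => -u x) (fun x => -v x) := fun x =>
  ⟨(h x).2.imp_left neg_le_neg, (h x).1.imp neg_le_neg fun h' => by simpa using h'⟩

lemma exists_peak {u v : ℝ → ℝ} (hu : Continuous u)
    (h : ∀ x, u x ≤ v x ∨ MidConvexAt u x) {a b c : ℝ} (hab : a ≤ b) (hbc : b ≤ c)
    (hua : u a < u b) (huc : u c < u b) : ∃ p, a ≤ p ∧ p ≤ c ∧ u b ≤ u p ∧ u p ≤ v p := by
  obtain ⟨q, hq, hqmax⟩ := isCompact_Icc.exists_isMaxOn ⟨b, hab, hbc⟩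
    (hu.continuousOn (s := Icc a c))
  have hcl : IsClosed {x | u x = u q} := isClosed_eq hu continuous_const
  obtain ⟨p, ⟨hp, hpq⟩, hleast⟩ := (isCompact_Icc.inter_right hcl).exists_isLeast ⟨q, hq, rfl⟩
  have hpq : u p = u q := hpq
  have hbq : u b ≤ u q := hqmax ⟨hab, hbc⟩
  refine ⟨p, hp.1, hp.2, hpq ▸ hbq, (h p).resolve_right ?_⟩
  rintro ⟨ε, hε, hmid⟩
  have hap : a < p := lt_of_le_of_ne hp.1 (by rintro rfl; linarith)
  have hpc : p < c := lt_of_le_of_ne hp.2 (by rintro rfl; linarith)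
  obtain ⟨t, ht0, ht⟩ := exists_between (lt_min hε (lt_min (sub_pos.2 hap) (sub_pos.2 hpc)))
  obtain ⟨ht1, ht2, ht3⟩ : t < ε ∧ t < p - a ∧ t < c - p := by simpa only [lt_min_iff] using ht
  have h1 := hmid t ht0 ht1
  have h2 : u (p + t) ≤ u q := hqmax ⟨by linarith, by linarith⟩
  have h3 : u (p - t) ≤ u q := hqmax ⟨by linarith, by linarith⟩
  have h4 : p ≤ p - t := hleast ⟨⟨by linarith, by linarith⟩, by
    change u (p - t) = u q
    linarith⟩
  linarith

lemma chainVar_neg (u : ℝ → ℝ) (l : List ℝ) (a b : ℝ) :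
    chainVar (fun x => -u x) a l b = chainVar u a l b := by
  induction l generalizing a with
  | nil => simp only [chainVar]; rw [← abs_neg]; ring_nf
  | cons c l ih => simp only [chainVar, ih]; rw [← abs_neg]; ring_nf

lemma chainVar_sub_le (u v : ℝ → ℝ) (l : List ℝ) (a b : ℝ) :
    chainVar (fun x => u x - v x) a l b ≤ chainVar u a l b + chainVar v a l b := by
  have key : ∀ c d, |(u d - v d) - (u c - v c)| ≤ |u d - u c| + |v d - v c| := fun c d => by
    rw [sub_sub_sub_comm]; exact abs_sub _ _
  induction l generalizing a with
  | nil => exact key a b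
  | cons c l ih => simp only [chainVar]; linarith [key a c, ih c]

lemma chainVar_change_head (u : ℝ → ℝ) (l : List ℝ) (a c b : ℝ) :
    chainVar u a l b - |u (l.headD b) - u a| = chainVar u c l b - |u (l.headD b) - u c| := by
  cases l <;> simp [chainVar]

lemma MonoChain.le_headD {a b : ℝ} {l : List ℝ} (h : MonoChain a l b) : a ≤ l.headD b := by
  cases l with
  | nil => exact h
  | cons c l => exact h.1

lemma MonoChain.change_head {a b c : ℝ} {l : List ℝ} (h : MonoChain a l b)
    (hc : c ≤ l.headD b) : MonoChain c l b := by
  cases l with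
  | nil => exact hc
  | cons d l => exact ⟨hc, h.2⟩

lemma Interlaced.exists_chain_of_lt {u v : ℝ → ℝ} (h : Interlaced u v) (hu : Continuous u)
    {a b : ℝ} {l : List ℝ} (hl : MonoChain a l b) (hlt : u a < u (l.headD b)) :
    ∃ m, MonoChain a m b ∧
      chainVar u a l b ≤ chainVar v a m b + (v a - u a) + |u b - v b| := by
  induction l generalizing u v a with
  | nil =>
    refine ⟨[], hl, ?_⟩
    simp only [chainVar, List.headD_nil] at hlt ⊢
    rw [abs_of_pos (sub_pos.2 hlt)]
    linarith [le_abs_self (v b - v a), le_abs_self (u b - v b)]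
  | cons c l ih =>
    obtain ⟨hac, hcl⟩ := hl
    have hlt : u a < u c := hlt
    have hce := hcl.le_headD
    set e := l.headD b with he
    simp only [chainVar]
    rw [abs_of_pos (sub_pos.2 hlt)]
    rcases le_or_gt (u c) (u e) with hue | hue
    · obtain ⟨m, hm, hle⟩ := ih h hu (hcl.change_head (hac.trans hce)) (hlt.trans_le hue)
      refine ⟨m, hm, le_trans (le_of_eq ?_) hle⟩
      have := chainVar_change_head u l a c b
      rw [← he, abs_of_nonneg (sub_nonneg.2 hue),
        abs_of_nonneg (sub_nonneg.2 (hlt.le.trans hue))] at this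
      linarith
    · obtain ⟨p, hap, hpe, hcp, hpv⟩ := exists_peak hu (fun x => (h x).1) hac hce hlt hue
      obtain ⟨m, hm, hle⟩ := ih h.neg hu.neg (hcl.change_head hpe)
        (neg_lt_neg (hue.trans_le hcp))
      refine ⟨p :: m, ⟨hap, hm⟩, ?_⟩
      have h1 := chainVar_change_head u l p c b
      rw [← he, abs_of_neg (sub_neg.2 hue), abs_of_neg (sub_neg.2 (hue.trans_le hcp))] at h1
      rw [chainVar_neg, chainVar_neg, neg_sub_neg, neg_sub_neg, abs_sub_comm (v b)] at hle
      simp only [chainVar]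
      linarith [le_abs_self (v p - v a)]

lemma Interlaced.exists_chain {u v : ℝ → ℝ} (h : Interlaced u v) (hu : Continuous u)
    {a b : ℝ} {l : List ℝ} (hl : MonoChain a l b) :
    ∃ m, MonoChain a m b ∧
      chainVar u a l b ≤ chainVar v a m b + |u a - v a| + |u b - v b| := by
  rcases lt_trichotomy (u a) (u (l.headD b)) with hlt | heq | hgt
  · obtain ⟨m, hm, hle⟩ := h.exists_chain_of_lt hu hl hlt
    exact ⟨m, hm, by linarith [neg_abs_le (u a - v a)]⟩
  · induction l with
    | nil =>
      refine ⟨[], hl, ?_⟩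
      have heq : u a = u b := heq
      simp only [chainVar, heq, sub_self, abs_zero]
      positivity
    | cons c l ih =>
      have heq : u a = u c := heq
      have hce := hl.2.le_headD
      have hal := hl.2.change_head (hl.1.trans hce)
      have : chainVar u a (c :: l) b = chainVar u a l b := by
        have := chainVar_change_head u l a c b
        rw [heq] at this
        simp only [chainVar, heq, sub_self, abs_zero]
        linarith
      rw [this]
      rcases lt_trichotomy (u a) (u (l.headD b)) with hlt | heq' | hgt
      · obtain ⟨m, hm, hle⟩ := h.exists_chain_of_lt hu hal hlt
        exact ⟨m, hm, by linarith [neg_abs_le (u a - v a)]⟩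
      · exact ih hal heq'
      · obtain ⟨m, hm, hle⟩ := h.neg.exists_chain_of_lt hu.neg hal (neg_lt_neg hgt)
        rw [chainVar_neg, chainVar_neg, neg_sub_neg, neg_sub_neg, abs_sub_comm (v b)] at hle
        exact ⟨m, hm, by linarith [le_abs_self (u a - v a)]⟩
  · obtain ⟨m, hm, hle⟩ := h.neg.exists_chain_of_lt hu.neg hl (neg_lt_neg hgt)
    rw [chainVar_neg, chainVar_neg, neg_sub_neg, neg_sub_neg, abs_sub_comm (v b)] at hle
    exact ⟨m, hm, by linarith [le_abs_self (u a - v a)]⟩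

lemma exists_chain_of_monotone {x : ℕ → ℝ} (hx : Monotone x) (n : ℕ) :
    ∃ l, MonoChain (x 0) l (x (n + 1)) ∧ ∀ u : ℝ → ℝ, chainVar u (x 0) l (x (n + 1)) =
      ∑ i ∈ Finset.range (n + 1), |u (x (i + 1)) - u (x i)| := by
  induction n generalizing x with
  | zero => exact ⟨[], hx (Nat.zero_le 1), fun u => by simp [chainVar]⟩
  | succ n ih =>
    obtain ⟨l, hl, hsum⟩ := ih (x := fun i => x (i + 1)) fun i j hij => hx (by omega)
    refine ⟨x 1 :: l, ⟨hx (Nat.zero_le 1), hl⟩, fun u => ?_⟩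
    rw [Finset.sum_range_succ', ← hsum u]
    simp only [chainVar]
    ring

/-! ### The Kantorovich distance -/

lemma abs_integral_sub_le_W {α β : Measure ℝ} (hα : MemM α) (hβ : MemM β)
    (hm : α.real univ = β.real univ) {g : ℝ → ℝ} (hg : ∀ a b, |g a - g b| ≤ 1 * |a - b|) :
    |∫ x, g x ∂α - ∫ x, g x ∂β| ≤ W α β := by
  have := hα.1
  have := hβ.1
  refine le_csSup ⟨∫ x, |x| ∂α + ∫ x, |x| ∂β, ?_⟩ ⟨g, ?_, rfl⟩
  · rintro d ⟨f, hf, rfl⟩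
    have hf' : ∀ a b, |f a - f b| ≤ 1 * |a - b| := fun a b => by
      simpa [Real.dist_eq] using hf.dist_le_mul a b
    have key : ∀ {γ : Measure ℝ}, MemM γ →
        |∫ x, f x ∂γ - γ.real univ * f 0| ≤ ∫ x, |x| ∂γ := fun {γ} hγ => by
      have := hγ.1
      have h1 : ∫ x, (f x - f 0) ∂γ = ∫ x, f x ∂γ - γ.real univ * f 0 := by
        rw [integral_sub (hγ.integrable (continuous_of_lipschitz hf') (linGrowth_of_lipschitz hf'))
          (integrable_const _)]
        simp
      rw [← h1]
      refine (abs_integral_le_integral_abs).trans (integral_mono_of_nonneg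
        (ae_of_all _ fun x => abs_nonneg _) hγ.2.abs (ae_of_all _ fun x => ?_))
      simpa using hf' x 0
    have h1 := abs_le.1 (key hα)
    have h2 := abs_le.1 (key hβ)
    rw [hm] at h1
    rw [abs_le]
    constructor <;> linarith [h1.1, h1.2, h2.1, h2.2]
  · exact LipschitzWith.of_dist_le_mul fun a b => by simpa [Real.dist_eq] using hg a b

lemma exists_test_function {α β : Measure ℝ} (hα : MemM α) (hβ : MemM β) {a b : ℝ} {l : List ℝ}
    (hl : MonoChain a l b) : ∃ g : ℝ → ℝ, (∀ x y, |g x - g y| ≤ 1 * |x - y|) ∧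
      (∀ y, y ≤ a → g y = g a) ∧ (∀ y, b ≤ y → g y = 0) ∧
      ∫ x, g x ∂α - ∫ x, g x ∂β = chainVar (fun x => pot α x - pot β x) a l b := by
  have single : ∀ a b : ℝ, a ≤ b → ∃ g : ℝ → ℝ, (∀ x y, |g x - g y| ≤ 1 * |x - y|) ∧
      (∀ y, y ≤ a → g y = g a) ∧ (∀ y, b ≤ y → g y = 0) ∧ ∫ x, g x ∂α - ∫ x, g x ∂β =
        |(pot α b - pot β b) - (pot α a - pot β a)| := fun a b hab => by
    obtain ⟨σ, hσ, hσ'⟩ : ∃ σ : ℝ, |σ| = 1 ∧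
        σ * ((pot α b - pot β b) - (pot α a - pot β a)) =
          |(pot α b - pot β b) - (pot α a - pot β a)| := by
      rcases le_total 0 ((pot α b - pot β b) - (pot α a - pot β a)) with h | h
      · exact ⟨1, by simp, by rw [abs_of_nonneg h, one_mul]⟩
      · exact ⟨-1, by simp, by rw [abs_of_nonpos h, neg_one_mul]⟩
    have hint : ∀ {γ : Measure ℝ}, MemM γ →
        ∫ y, σ * (max (b - y) 0 - max (a - y) 0) ∂γ = σ * (pot γ b - pot γ a) := fun {γ} hγ => by
      rw [integral_const_mul, integral_sub (hγ.integrable_hinge b) (hγ.integrable_hinge a)]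
      rfl
    have hanti : ∀ x y : ℝ, x ≤ y → |(max (b - x) 0 - max (a - x) 0) -
        (max (b - y) 0 - max (a - y) 0)| ≤ |x - y| := fun x y hxy => by
      rw [abs_of_nonpos (sub_nonpos.2 hxy), abs_le]
      rcases max_cases (b - x) 0 with h1 | h1 <;> rcases max_cases (a - x) 0 with h2 | h2 <;>
      rcases max_cases (b - y) 0 with h3 | h3 <;> rcases max_cases (a - y) 0 with h4 | h4 <;>
      constructor <;> linarith
    refine ⟨fun y => σ * (max (b - y) 0 - max (a - y) 0), fun x y => ?_, fun y hy => ?_,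
      fun y hy => ?_, ?_⟩
    · rw [← mul_sub, abs_mul, hσ, one_mul, one_mul]
      rcases le_total x y with h | h
      · exact hanti x y h
      · rw [abs_sub_comm, abs_sub_comm x y]; exact hanti y x h
    · simp only
      rw [max_eq_left (by linarith), max_eq_left (by linarith), max_eq_left (by linarith),
        max_eq_left (by linarith)]
      ring
    · simp only
      rw [max_eq_right (by linarith), max_eq_right (by linarith)]
      ring
    · rw [hint hα, hint hβ, ← hσ']; ring
  induction l generalizing a with
  | nil => exact single a b hl
  | cons c l ih =>
    obtain ⟨g₁, hg₁, hl₁, hr₁, hi₁⟩ := single a c hl.1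
    obtain ⟨g₂, hg₂, hl₂, hr₂, hi₂⟩ := ih hl.2
    have hcb : c ≤ b := by
      have : ∀ (l : List ℝ) (c : ℝ), MonoChain c l b → c ≤ b := fun l => by
        induction l with
        | nil => exact fun c h => h
        | cons d l ih => exact fun c h => h.1.trans (ih d h.2)
      exact this l c hl.2
    have hi : ∀ {γ : Measure ℝ}, MemM γ →
        ∫ x, (g₁ x + g₂ x) ∂γ = ∫ x, g₁ x ∂γ + ∫ x, g₂ x ∂γ := fun {γ} hγ =>
      integral_add (hγ.integrable (continuous_of_lipschitz hg₁) (linGrowth_of_lipschitz hg₁))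
        (hγ.integrable (continuous_of_lipschitz hg₂) (linGrowth_of_lipschitz hg₂))
    have hle : ∀ x y, x ≤ y → |(g₁ x + g₂ x) - (g₁ y + g₂ y)| ≤ 1 * |x - y| := fun x y hxy => by
      rw [add_sub_add_comm]
      refine (abs_add_le _ _).trans ?_
      rcases le_total y c with hy | hy
      · rw [hl₂ y hy, hl₂ x (hxy.trans hy), sub_self, abs_zero, add_zero]
        exact hg₁ x y
      · rcases le_total x c with hx | hx
        · have h1 := hg₁ x c
          have h2 := hg₂ c y
          rw [hl₂ x hx, hr₁ y hy, ← hr₁ c le_rfl]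
          rw [abs_of_nonpos (sub_nonpos.2 hx)] at h1
          rw [abs_of_nonpos (sub_nonpos.2 hy)] at h2
          rw [abs_of_nonpos (sub_nonpos.2 hxy)]
          linarith
        · rw [hr₁ x hx, hr₁ y hy, sub_self, abs_zero, zero_add]
          exact hg₂ x y
    refine ⟨fun x => g₁ x + g₂ x, fun x y => ?_, fun y hy => ?_, fun y hy => ?_, ?_⟩
    · rcases le_total x y with h | h
      · exact hle x y h
      · rw [abs_sub_comm, abs_sub_comm x y]; exact hle y x h
    · simp only
      rw [hl₁ y hy, hl₂ y (hy.trans hl.1), hl₂ a hl.1]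
    · simp only
      rw [hr₁ y (hcb.trans hy), hr₂ y hy, add_zero]
    · rw [hi hα, hi hβ, chainVar, ← hi₁, ← hi₂]; ring

lemma chainVar_pot_le_W {α β : Measure ℝ} (hα : MemM α) (hβ : MemM β)
    (hm : α.real univ = β.real univ) {a b : ℝ} {l : List ℝ} (hl : MonoChain a l b) :
    chainVar (fun x => pot α x - pot β x) a l b ≤ W α β := by
  obtain ⟨g, hg, -, -, hi⟩ := exists_test_function hα hβ hl
  rw [← hi]
  exact (le_abs_self _).trans (abs_integral_sub_le_W hα hβ hm hg)

/-! ### Greatest convex minorants -/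

/-- `h` is the greatest convex function below `D`. -/
def IsConvexHull (D h : ℝ → ℝ) : Prop :=
  ConvexOn ℝ univ h ∧ (∀ x, h x ≤ D x) ∧
    ∀ g : ℝ → ℝ, ConvexOn ℝ univ g → (∀ x, g x ≤ D x) → ∀ x, g x ≤ h x

lemma exists_isConvexHull {D C : ℝ → ℝ} (hC : ConvexOn ℝ univ C) (hCD : ∀ x, C x ≤ D x) :
    ∃ h, IsConvexHull D h := by
  set G : Set (ℝ → ℝ) := {g | ConvexOn ℝ univ g ∧ ∀ x, g x ≤ D x} with hG
  have hbdd : ∀ x, BddAbove ((fun g : ℝ → ℝ => g x) '' G) := fun x =>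
    ⟨D x, by rintro _ ⟨g, hg, rfl⟩; exact hg.2 x⟩
  have hne : ∀ x, ((fun g : ℝ → ℝ => g x) '' G).Nonempty := fun x => ⟨C x, C, ⟨hC, hCD⟩, rfl⟩
  have hle : ∀ g ∈ G, ∀ x, g x ≤ sSup ((fun g : ℝ → ℝ => g x) '' G) := fun g hg x =>
    le_csSup (hbdd x) ⟨g, hg, rfl⟩
  refine ⟨fun x => sSup ((fun g : ℝ → ℝ => g x) '' G),
    ⟨convex_univ, fun x _ y _ a b ha hb hab => ?_⟩, fun x => ?_, fun g hg hgD x => ?_⟩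
  · refine csSup_le (hne _) ?_
    rintro _ ⟨g, hg, rfl⟩
    refine (hg.1.2 (mem_univ x) (mem_univ y) ha hb hab).trans ?_
    simp only [smul_eq_mul]
    exact add_le_add (mul_le_mul_of_nonneg_left (hle g hg x) ha)
      (mul_le_mul_of_nonneg_left (hle g hg y) hb)
  · refine csSup_le (hne x) ?_
    rintro _ ⟨g, hg, rfl⟩
    exact hg.2 x
  · exact hle g ⟨hg, hgD⟩ x

lemma IsConvexHull.midConvexAt_neg {D h : ℝ → ℝ} (hh : IsConvexHull D h) (hD : Continuous D)
    {x : ℝ} (hx : h x < D x) : MidConvexAt (fun y => -h y) x := by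
  obtain ⟨m, hm1, hm2⟩ := exists_between hx
  have hcont := continuous_of_convexOn hh.1
  have hev : ∀ᶠ y in nhds x, h y < m ∧ m < D y :=
    (hcont.continuousAt.eventually_lt continuousAt_const hm1).and
      (continuousAt_const.eventually_lt hD.continuousAt hm2)
  obtain ⟨ε, hε, hball⟩ := Metric.eventually_nhds_iff.1 hev
  refine ⟨ε, hε, fun t ht htε => ?_⟩
  set p := x - t with hp
  set q := x + t with hq
  have hpq : p < q := by linarith
  have hdist : ∀ y, p ≤ y → y ≤ q → h y < m ∧ m < D y := fun y h1 h2 =>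
    hball (by rw [Real.dist_eq, abs_lt]; constructor <;> linarith)
  set s := (h q - h p) / (q - p) with hs
  have hsq : s * (q - p) = h q - h p := div_mul_cancel₀ _ (sub_pos.2 hpq).ne'
  have hℓ : ConvexOn ℝ univ fun y : ℝ => h p + s * (y - p) :=
    ⟨convex_univ, fun a _ b _ c d _ _ hcd => le_of_eq (by
      simp only [smul_eq_mul]
      obtain rfl : d = 1 - c := by linarith
      ring)⟩
  have hle : ∀ y, max (h y) (h p + s * (y - p)) ≤ D y := fun y => by
    refine max_le (hh.2.1 y) ?_
    rcases lt_or_ge y p with hy | hy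
    · have h1 := hh.1.slope_mono_adjacent (mem_univ y) (mem_univ q) hy hpq
      rw [← hs, div_le_iff₀ (sub_pos.2 hy)] at h1
      linarith [hh.2.1 y]
    rcases lt_or_ge q y with hy' | hy'
    · have h1 := hh.1.slope_mono_adjacent (mem_univ p) (mem_univ y) hpq hy'
      rw [← hs, le_div_iff₀ (sub_pos.2 hy')] at h1
      linarith [hh.2.1 y]
    · refine le_of_lt (lt_of_le_of_lt ?_ (hdist y hy hy').2)
      have h1 := (hdist p le_rfl hpq.le).1
      have h2 := (hdist q hpq.le le_rfl).1
      rcases le_total 0 s with h0 | h0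
      · nlinarith
      · nlinarith
  have h1 := (le_max_right _ _).trans (hh.2.2 _ (hh.1.sup hℓ) hle x)
  have h2 : q - p = 2 * (x - p) := by rw [hp, hq]; ring
  rw [h2] at hsq
  linarith

lemma ConvexOn.two_mul_le {f : ℝ → ℝ} (hf : ConvexOn ℝ univ f) (x t : ℝ) :
    2 * f x ≤ f (x - t) + f (x + t) := by
  have := hf.2 (mem_univ (x - t)) (mem_univ (x + t)) (show (0 : ℝ) ≤ 1 / 2 by norm_num)
    (show (0 : ℝ) ≤ 1 / 2 by norm_num) (by norm_num)
  simp only [smul_eq_mul] at this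
  rw [show 1 / 2 * (x - t) + 1 / 2 * (x + t) = x by ring] at this
  linarith

lemma IsConvexHull.convexOn_sub {f g h : ℝ → ℝ} (hf : ConvexOn ℝ univ f)
    (hg : ConvexOn ℝ univ g) (hh : IsConvexHull (fun x => f x - g x) h) :
    ConvexOn ℝ univ fun x => f x - h x := by
  have hfc := continuous_of_convexOn hf
  have hgc := continuous_of_convexOn hg
  have hhc := continuous_of_convexOn hh.1
  refine LinearOrder.convexOn_of_lt convex_univ fun x _ y _ hxy a b ha hb hab => ?_
  have hyx := sub_pos.2 hxy
  simp only [smul_eq_mul]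
  set z := a * x + b * y with hz
  set s := ((f y - h y) - (f x - h x)) / (y - x) with hs
  have hsy : s * (y - x) = (f y - h y) - (f x - h x) := div_mul_cancel₀ _ hyx.ne'
  set ℓ : ℝ → ℝ := fun w => (f x - h x) + s * (w - x) with hℓ
  have hℓz : ℓ z = a * (f x - h x) + b * (f y - h y) := by
    have : f y - h y = s * (y - x) + (f x - h x) := by linarith
    rw [this]
    simp only [hℓ, hz]
    obtain rfl : a = 1 - b := by linarith
    ring
  rw [← hℓz]
  by_contra! hlt
  have hxz : x ≤ z := by
    have : z = x + b * (y - x) := by rw [hz, show a = 1 - b by linarith]; ring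
    nlinarith [mul_pos hb hyx]
  have hzy : z ≤ y := by
    have : z = y - a * (y - x) := by rw [hz, show b = 1 - a by linarith]; ring
    nlinarith [mul_pos ha hyx]
  have hℓx : ℓ x = f x - h x := by simp [hℓ]
  have hℓy : ℓ y = f y - h y := by simp only [hℓ]; linarith
  have hle : ∀ w, g w ≤ f w - h w := fun w => by linarith [hh.2.1 w]
  obtain ⟨p, hxp, hpy, hzp, hpv⟩ := exists_peak (u := fun w => f w - h w - ℓ w)
    (v := fun w => g w - ℓ w) (by fun_prop) (fun w => by
      rcases (hh.2.1 w).eq_or_lt with hw | hw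
      · left; linarith
      · right
        obtain ⟨ε, hε, hmid⟩ := hh.midConvexAt_neg (hfc.sub hgc) hw
        refine ⟨ε, hε, fun t ht htε => ?_⟩
        have h1 := hmid t ht htε
        have h2 := hf.two_mul_le w t
        have h3 : ℓ (w - t) + ℓ (w + t) = 2 * ℓ w := by simp only [hℓ]; ring
        linarith) hxz hzy (by simp only [hℓx]; linarith) (by simp only [hℓy]; linarith)
  have hgp : g p * (y - x) ≤ (y - p) * g x + (p - x) * g y := by
    have := hg.2 (mem_univ x) (mem_univ y)
      (show 0 ≤ (y - p) / (y - x) from div_nonneg (by linarith) hyx.le)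
      (show 0 ≤ (p - x) / (y - x) from div_nonneg (by linarith) hyx.le)
      (by field_simp; ring)
    simp only [smul_eq_mul] at this
    rw [show (y - p) / (y - x) * x + (p - x) / (y - x) * y = p by field_simp; ring] at this
    calc g p * (y - x) ≤ ((y - p) / (y - x) * g x + (p - x) / (y - x) * g y) * (y - x) :=
          mul_le_mul_of_nonneg_right this hyx.le
      _ = _ := by field_simp
  have h1 : (y - p) * g x ≤ (y - p) * (f x - h x) :=
    mul_le_mul_of_nonneg_left (hle x) (by linarith)
  have h2 : (p - x) * g y ≤ (p - x) * (f y - h y) :=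
    mul_le_mul_of_nonneg_left (hle y) (by linarith)
  have h3 : ℓ p * (y - x) = (y - p) * (f x - h x) + (p - x) * (f y - h y) := by
    have : f y - h y = s * (y - x) + (f x - h x) := by linarith
    rw [this]
    simp only [hℓ]
    ring
  have h4 : g p ≤ ℓ p := le_of_mul_le_mul_right (by linarith) hyx
  linarith

/-! ### Measures with prescribed potential -/

/-- `S` is a monotone selection of slopes of `g`. -/
def IsSlope (g S : ℝ → ℝ) : Prop :=
  ∀ x y, x ≤ y → S x * (y - x) ≤ g y - g x ∧ g y - g x ≤ S y * (y - x)

lemma ConvexOn.exists_isSlope {g : ℝ → ℝ} (hg : ConvexOn ℝ univ g) :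
    ∃ S : StieltjesFunction ℝ, IsSlope g S := by
  have hgc := continuous_of_convexOn hg
  set k : ℝ → ℝ := fun x => derivWithin g (Ioi x) x with hk
  have hint : ∀ x : ℝ, x ∈ interior (univ : Set ℝ) := fun x => by simp
  have hlow : ∀ x y, x < y → k x * (y - x) ≤ g y - g x := fun x y hxy => by
    have := hg.rightDeriv_le_slope_of_mem_interior (hint x) (mem_univ y) hxy
    rwa [slope_def_field, le_div_iff₀ (sub_pos.2 hxy)] at this
  have hup : ∀ x y, x < y → g y - g x ≤ k y * (y - x) := fun x y hxy => by
    have := (hg.slope_le_leftDeriv_of_mem_interior (mem_univ x) (hint y) hxy).trans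
      (hg.leftDeriv_le_rightDeriv_of_mem_interior (hint y))
    rwa [slope_def_field, div_le_iff₀ (sub_pos.2 hxy)] at this
  have hmono : Monotone k := by
    intro x y hxy
    exact hg.monotoneOn_rightDeriv (hint x) (hint y) hxy
  refine ⟨hmono.stieltjesFunction, fun x y hxy => ?_⟩
  rw [hmono.stieltjesFunction_eq, hmono.stieltjesFunction_eq]
  rcases hxy.eq_or_lt with rfl | hxy
  · simp
  constructor
  · have h1 : Tendsto (fun w => k.rightLim x * (y - w)) (nhdsWithin x (Ioi x))
        (nhds (k.rightLim x * (y - x))) :=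
      (Continuous.tendsto (by fun_prop) x).mono_left nhdsWithin_le_nhds
    have h2 : Tendsto (fun w => g y - g w) (nhdsWithin x (Ioi x)) (nhds (g y - g x)) :=
      (Continuous.tendsto (by fun_prop) x).mono_left nhdsWithin_le_nhds
    refine le_of_tendsto_of_tendsto h1 h2 ?_
    filter_upwards [Ioo_mem_nhdsGT hxy] with w hw
    exact (mul_le_mul_of_nonneg_right (hmono.rightLim_le hw.1) (by linarith [hw.2])).trans
      (hlow w y hw.2)
  · exact (hup x y hxy).trans
      (mul_le_mul_of_nonneg_right (hmono.le_rightLim le_rfl) (by linarith))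

lemma IsSlope.add {g₁ g₂ S₁ S₂ : ℝ → ℝ} (h₁ : IsSlope g₁ S₁) (h₂ : IsSlope g₂ S₂) :
    IsSlope (fun x => g₁ x + g₂ x) (fun x => S₁ x + S₂ x) := fun x y hxy => by
  have := h₁ x y hxy
  have := h₂ x y hxy
  constructor <;> linarith

lemma IsSlope.unique {g : ℝ → ℝ} {S T : StieltjesFunction ℝ} (hS : IsSlope g S)
    (hT : IsSlope g T) : S = T := by
  have key : ∀ {S T : StieltjesFunction ℝ}, IsSlope g S → IsSlope g T → ∀ x, S x ≤ T x := by
    intro S T hS hT x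
    have h1 : Tendsto T (nhdsWithin x (Ioi x)) (nhds (T x)) :=
      (T.right_continuous x).mono_left (nhdsWithin_mono x Ioi_subset_Ici_self)
    refine ge_of_tendsto h1 ?_
    filter_upwards [self_mem_nhdsWithin] with y hy
    have hy : x < y := hy
    exact le_of_mul_le_mul_right ((hS x y hy.le).1.trans (hT x y hy.le).2) (sub_pos.2 hy)
  ext x
  exact le_antisymm (key hS hT x) (key hT hS x)

lemma IsSlope.sub_eq {g₁ g₂ S : ℝ → ℝ} (h₁ : IsSlope g₁ S) (h₂ : IsSlope g₂ S) (x y : ℝ) :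
    g₁ x - g₂ x = g₁ y - g₂ y := by
  wlog hxy : x ≤ y generalizing x y
  · exact (this y x (le_of_not_ge hxy)).symm
  have step : ∀ a b, a ≤ b → |(g₁ b - g₂ b) - (g₁ a - g₂ a)| ≤ (S b - S a) * (b - a) :=
    fun a b hab => by
      have := h₁ a b hab
      have := h₂ a b hab
      rw [abs_le]
      constructor <;> linarith
  have hbound : ∀ n : ℕ, |(g₁ y - g₂ y) - (g₁ x - g₂ x)| ≤
      (S y - S x) * (y - x) * (1 / (n + 1 : ℝ)) := fun n => by
    set d := (y - x) * (1 / (n + 1 : ℝ)) with hd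
    have hd0 : 0 ≤ d := mul_nonneg (sub_nonneg.2 hxy) (by positivity)
    have hi : ∀ i : ℕ, |(g₁ (x + i * d) - g₂ (x + i * d)) - (g₁ x - g₂ x)| ≤
        (S (x + i * d) - S x) * d := fun i => by
      induction i with
      | zero => simp
      | succ i ih =>
        have h1 := step (x + i * d) (x + (i + 1 : ℕ) * d) (by push_cast; nlinarith)
        have h2 : x + (i + 1 : ℕ) * d - (x + i * d) = d := by push_cast; ring
        rw [h2] at h1
        have h3 := abs_sub_le (g₁ (x + (i + 1 : ℕ) * d) - g₂ (x + (i + 1 : ℕ) * d))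
          (g₁ (x + i * d) - g₂ (x + i * d)) (g₁ x - g₂ x)
        linarith
    have := hi (n + 1)
    have hy : x + (n + 1 : ℕ) * d = y := by
      rw [hd]; push_cast; field_simp; ring
    rw [hy] at this
    rwa [mul_assoc]
  have hlim : Tendsto (fun n : ℕ => (S y - S x) * (y - x) * (1 / (n + 1 : ℝ))) atTop (nhds 0) := by
    simpa using (tendsto_one_div_add_atTop_nhds_zero_nat (𝕜 := ℝ)).const_mul _
  have h0 := ge_of_tendsto' hlim hbound
  have := abs_eq_zero.1 (le_antisymm h0 (abs_nonneg _))
  linarith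

lemma exists_stieltjes_measure (ν : Measure ℝ) [IsFiniteMeasure ν] :
    ∃ F : StieltjesFunction ℝ, ∀ x, F x = ν.real (Iic x) := by
  refine ⟨⟨fun x => ν.real (Iic x), fun x y hxy => measureReal_mono (Iic_subset_Iic.2 hxy),
    fun x => ?_⟩, fun x => rfl⟩
  rw [← continuousWithinAt_Ioi_iff_Ici]
  have h := tendsto_measure_biInter_gt (μ := ν) (s := fun y : ℝ => Iic y) (a := x)
    (fun r _ => measurableSet_Iic.nullMeasurableSet) (fun i j _ hij => Iic_subset_Iic.2 hij)
    ⟨x + 1, by simp, measure_ne_top _ _⟩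
  have hset : (⋂ r > x, Iic r) = Iic x := by
    ext y
    simp only [mem_iInter, mem_Iic]
    exact ⟨fun h => le_of_forall_gt_imp_ge_of_dense h, fun h r hr => h.trans hr.le⟩
  rw [hset] at h
  exact (ENNReal.tendsto_toReal (measure_ne_top ν _)).comp h

lemma isSlope_pot {μ : Measure ℝ} (hμ : MemM μ) : IsSlope (pot μ) fun x => μ.real (Iic x) := by
  have := hμ.1
  intro x y hxy
  have hind : ∀ a c : ℝ, ∫ z, (Iic a).indicator (fun _ => c) z ∂μ = μ.real (Iic a) * c :=
    fun a c => by rw [integral_indicator_const c measurableSet_Iic, smul_eq_mul]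
  have hint : ∀ a c : ℝ, Integrable ((Iic a).indicator fun _ : ℝ => c) μ := fun a c =>
    (integrable_const c).indicator measurableSet_Iic
  rw [pot, pot, ← integral_sub (hμ.integrable_hinge y) (hμ.integrable_hinge x), ← hind, ← hind]
  have hi := (hμ.integrable_hinge y).sub (hμ.integrable_hinge x)
  constructor
  · refine integral_mono (hint _ _) hi fun z => ?_
    simp only [indicator_apply, mem_Iic]
    split_ifs with hz
    · rw [max_eq_left (by linarith), max_eq_left (by linarith)]; linarith
    · exact sub_nonneg.2 (max_le_max (by linarith) le_rfl)
  · refine integral_mono hi (hint _ _) fun z => ?_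
    simp only [indicator_apply, mem_Iic]
    split_ifs with hz
    · rw [max_eq_left (by linarith : 0 ≤ y - z)]; linarith [le_max_left (x - z) 0]
    · rw [max_eq_right (by linarith), max_eq_right (by linarith)]; simp

lemma exists_measure_of_pot_eq_add {ν : Measure ℝ} (hν : MemM ν) {h q : ℝ → ℝ}
    (hh : ConvexOn ℝ univ h) (hq : ConvexOn ℝ univ q) (hsum : ∀ x, pot ν x = h x + q x)
    (hlim : Tendsto h atBot (nhds 0)) :
    ∃ κ ρ : Measure ℝ, κ + ρ = ν ∧ ∀ x, pot κ x = h x := by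
  have := hν.1
  obtain ⟨S, hS⟩ := hh.exists_isSlope
  obtain ⟨T, hT⟩ := hq.exists_isSlope
  obtain ⟨F, hF⟩ := exists_stieltjes_measure ν
  have hFν : F.measure = ν := by
    refine (Measure.ext_of_Ioc _ _ fun a b hab => ?_).symm
    rw [F.measure_Ioc, hF, hF, ← measureReal_sdiff (Iic_subset_Iic.2 hab.le) measurableSet_Iic,
      Iic_sdiff_Iic, ofReal_measureReal]
  have hST : S + T = F := by
    refine IsSlope.unique (g := pot ν) ?_ ?_
    · have h1 := hS.add hT
      rwa [← funext hsum] at h1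
    · rw [show (F : ℝ → ℝ) = fun x => ν.real (Iic x) from funext hF]
      exact isSlope_pot hν
  have hκρ : S.measure + T.measure = ν := by
    rw [← StieltjesFunction.measure_add, hST, hFν]
  refine ⟨S.measure, T.measure, hκρ, ?_⟩
  have hκ : MemM S.measure := hν.of_le (hκρ ▸ Measure.le_add_right le_rfl)
  have hS0 : Tendsto S atBot (nhds 0) := by
    have h1 : Tendsto (fun x => h x - h (x - 1)) atBot (nhds 0) := by
      simpa [Function.comp_def, ← sub_eq_add_neg] using hlim.sub (hlim.comp (tendsto_atBot_add_const_right _ (-1) tendsto_id))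
    have h2 : Tendsto (fun x => h (x + 1) - h x) atBot (nhds 0) := by
      simpa using (hlim.comp (tendsto_atBot_add_const_right _ 1 tendsto_id)).sub hlim
    refine tendsto_of_tendsto_of_tendsto_of_le_of_le h1 h2 (fun x => ?_) (fun x => ?_)
    · have := (hS (x - 1) x (by linarith)).2
      simpa using this
    · have := (hS x (x + 1) (by linarith)).1
      simpa using this
  have hSκ : (S : ℝ → ℝ) = fun x => S.measure.real (Iic x) := funext fun x => by
    rw [measureReal_def, S.measure_Iic hS0, sub_zero,
      ENNReal.toReal_ofReal (S.mono.le_of_tendsto hS0 x)]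
  have hslope := isSlope_pot hκ
  rw [← hSκ] at hslope
  intro x
  have hc : ∀ y, pot S.measure y - h y = pot S.measure x - h x := fun y => hslope.sub_eq hS y x
  have h0 := (pot_tendsto_atBot hκ).sub hlim
  rw [sub_zero] at h0
  have := tendsto_nhds_unique (tendsto_const_nhds.congr fun y => (hc y).symm) h0
  linarith

/-! ### The potential of the shadow -/

lemma mass_mean_eq_of_pot_tendsto {α β : Measure ℝ} (hα : MemM α) (hβ : MemM β)
    (h : Tendsto (fun x => pot α x - pot β x) atTop (nhds 0)) :
    α.real univ = β.real univ ∧ ∫ y, y ∂α = ∫ y, y ∂β := by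
  have h1 : Tendsto (fun x => (α.real univ - β.real univ) * x - (∫ y, y ∂α - ∫ y, y ∂β))
      atTop (nhds 0) := by
    have := h.sub ((pot_sub_tendsto_atTop hα).sub (pot_sub_tendsto_atTop hβ))
    rw [sub_zero, sub_zero] at this
    exact this.congr fun x => by ring
  have h2 := (h1.comp (tendsto_atTop_add_const_right _ 1 tendsto_id)).sub h1
  have hm : α.real univ - β.real univ = 0 := by
    rw [sub_zero] at h2
    refine tendsto_nhds_unique (tendsto_const_nhds.congr fun x => ?_) h2
    simp only [Function.comp, id]
    ring
  rw [hm] at h1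
  have hb := tendsto_nhds_unique (tendsto_const_nhds.congr fun x => by ring) h1
    (a := -(∫ y, y ∂α - ∫ y, y ∂β))
  constructor <;> linarith

lemma IsShadow.exists_compl {μ ν η : Measure ℝ} (hν : MemM ν) (hη : IsShadow μ ν η) :
    ∃ κ, MemM κ ∧ ∀ x, pot κ x = pot ν x - pot η x := by
  have hηM := hν.of_le hη.2.1
  have := hηM.1
  have hadd : ν - η + η = ν := Measure.sub_add_cancel_of_le hη.2.1
  have hκ : MemM (ν - η) := hν.of_le Measure.sub_le
  refine ⟨ν - η, hκ, fun x => ?_⟩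
  have := pot_add hκ hηM x
  rw [hadd] at this
  linarith

lemma IsShadow.isConvexHull {μ ν η : Measure ℝ} (hμ : MemM μ) (hν : MemM ν)
    (hη : IsShadow μ ν η) :
    IsConvexHull (fun x => pot ν x - pot μ x) fun x => pot ν x - pot η x := by
  have hηM := hν.of_le hη.2.1
  obtain ⟨κ, hκ, hpκ⟩ := hη.exists_compl hν
  have hC : ConvexOn ℝ univ fun x => pot ν x - pot η x := by
    rw [← funext hpκ]; exact pot_convexOn hκ
  have hCD : ∀ x, pot ν x - pot η x ≤ pot ν x - pot μ x := fun x => by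
    linarith [hη.1.pot_le x]
  obtain ⟨h, hh⟩ := exists_isConvexHull hC hCD
  have hCh := hh.2.2 _ hC hCD
  have hq := hh.convexOn_sub (pot_convexOn hν) (pot_convexOn hμ)
  have hlim : Tendsto h atBot (nhds 0) :=
    tendsto_of_tendsto_of_tendsto_of_le_of_le (pot_sub_pot_tendsto_atBot hν hηM)
      (pot_sub_pot_tendsto_atBot hν hμ) hCh hh.2.1
  obtain ⟨τ, ρ, hτρ, hpτ⟩ := exists_measure_of_pot_eq_add hν hh.1 hq (fun x => by ring) hlim
  have hτ : MemM τ := hν.of_le (hτρ ▸ Measure.le_add_right le_rfl)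
  have hρle : ρ ≤ ν := hτρ ▸ Measure.le_add_left le_rfl
  have hρ : MemM ρ := hν.of_le hρle
  have hpρ : ∀ x, pot ρ x = pot ν x - h x := fun x => by
    have := pot_add hτ hρ x
    rw [hτρ, hpτ] at this
    linarith
  have hμρ : ∀ x, pot μ x ≤ pot ρ x := fun x => by linarith [hh.2.1 x, hpρ x]
  have hρη : ∀ x, pot ρ x ≤ pot η x := fun x => by linarith [hCh x, hpρ x]
  have htop : Tendsto (fun x => pot ρ x - pot μ x) atTop (nhds 0) :=
    tendsto_of_tendsto_of_tendsto_of_le_of_le tendsto_const_nhds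
      (pot_sub_pot_tendsto_atTop hηM hμ hη.1.measureReal_eq.symm hη.1.integral_id_eq.symm)
      (fun x => sub_nonneg.2 (hμρ x)) (fun x => sub_le_sub_right (hρη x) _)
  obtain ⟨hm, hb⟩ := mass_mean_eq_of_pot_tendsto hρ hμ htop
  have hle := hη.2.2 ρ (leC_of_pot_le hμ hρ hm.symm hb.symm hμρ) hρle
  have heq : h = fun x => pot ν x - pot η x := funext fun x =>
    le_antisymm (by linarith [hle.pot_le x, hpρ x]) (hCh x)
  exact heq ▸ hh

lemma IsConvexHull.interlaced_sub {D₁ D₂ C₁ C₂ : ℝ → ℝ} (h₁ : IsConvexHull D₁ C₁)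
    (h₂ : IsConvexHull D₂ C₂) (hD₁ : Continuous D₁) (hD₂ : Continuous D₂) :
    Interlaced (fun x => C₁ x - C₂ x) (fun x => D₁ x - D₂ x) := by
  intro x
  constructor
  · rcases (h₂.2.1 x).eq_or_lt with h | h
    · left; linarith [h₁.2.1 x]
    · right
      obtain ⟨ε, hε, hmid⟩ := h₂.midConvexAt_neg hD₂ h
      refine ⟨ε, hε, fun t ht htε => ?_⟩
      linarith [hmid t ht htε, h₁.1.two_mul_le x t]
  · rcases (h₁.2.1 x).eq_or_lt with h | h
    · left; linarith [h₂.2.1 x]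
    · right
      obtain ⟨ε, hε, hmid⟩ := h₁.midConvexAt_neg hD₁ h
      refine ⟨ε, hε, fun t ht htε => ?_⟩
      linarith [hmid t ht htε, h₂.1.two_mul_le x t]

/-- Lipschitz continuity of the shadow projection in both arguments. -/
theorem shadow_lipschitz (μ μ' ν ν' : Measure ℝ) (hμ : MemM μ) (hμ' : MemM μ')
    (hν : MemM ν) (hν' : MemM ν')
    (hmassμ : μ Set.univ = μ' Set.univ) (hmassν : ν Set.univ = ν' Set.univ)
    (h₁ : leCP μ ν) (h₂ : leCP μ' ν')
    (η η' : Measure ℝ) (hη : IsShadow μ ν η) (hη' : IsShadow μ' ν' η') :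
    W η η' ≤ W μ μ' + 2 * W ν ν' := by
  have hηM := hν.of_le hη.2.1
  have hηM' := hν'.of_le hη'.2.1
  have hmμ : μ.real univ = μ'.real univ := by simp only [measureReal_def, hmassμ]
  have hmν : ν.real univ = ν'.real univ := by simp only [measureReal_def, hmassν]
  have hmη : η.real univ = η'.real univ := by
    rw [← hη.1.measureReal_eq, ← hη'.1.measureReal_eq, hmμ]
  have hcont : ∀ {γ : Measure ℝ}, MemM γ → Continuous (pot γ) := fun hγ =>
    continuous_of_convexOn (pot_convexOn hγ)
  have hcν := hcont hν
  have hcν' := hcont hν'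
  have hcμ := hcont hμ
  have hcμ' := hcont hμ'
  have hcη := hcont hηM
  have hcη' := hcont hηM'
  set u : ℝ → ℝ := fun x => (pot ν x - pot η x) - (pot ν' x - pot η' x) with hu
  set v : ℝ → ℝ := fun x => (pot ν x - pot μ x) - (pot ν' x - pot μ' x) with hv
  have huv : Interlaced u v := (hη.isConvexHull hμ hν).interlaced_sub (hη'.isConvexHull hμ' hν')
    (by fun_prop) (by fun_prop)
  have hu_cont : Continuous u := by fun_prop
  set e : ℝ → ℝ := fun x => |u x - v x| with he
  have he_eq : e = fun x => |(pot μ x - pot η x) - (pot μ' x - pot η' x)| := by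
    funext x; simp only [he, hu, hv]; congr 1; ring
  have hbot : Tendsto e atBot (nhds 0) := by
    rw [he_eq]
    simpa using ((pot_sub_pot_tendsto_atBot hμ hηM).sub
      (pot_sub_pot_tendsto_atBot hμ' hηM')).abs
  have htop : Tendsto e atTop (nhds 0) := by
    rw [he_eq]
    simpa using ((pot_sub_pot_tendsto_atTop hμ hηM hη.1.measureReal_eq hη.1.integral_id_eq).sub
      (pot_sub_pot_tendsto_atTop hμ' hηM' hη'.1.measureReal_eq hη'.1.integral_id_eq)).abs
  have hvar : ∀ {a b : ℝ} {l : List ℝ}, MonoChain a l b →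
      chainVar (fun x => pot η x - pot η' x) a l b ≤ W μ μ' + 2 * W ν ν' + e a + e b := by
    intro a b l hl
    obtain ⟨m, hm, hle⟩ := huv.exists_chain hu_cont hl
    have h1 := chainVar_sub_le (fun x => pot ν x - pot ν' x) u l a b
    have h2 := chainVar_sub_le (fun x => pot ν x - pot ν' x) (fun x => pot μ x - pot μ' x) m a b
    have h3 : (fun x => (pot ν x - pot ν' x) - u x) = fun x => pot η x - pot η' x := by
      funext x; simp only [hu]; ring
    have h4 : (fun x => (pot ν x - pot ν' x) - (pot μ x - pot μ' x)) = v := by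
      funext x; simp only [hv]; ring
    rw [h3] at h1
    rw [h4] at h2
    linarith [chainVar_pot_le_W hν hν' hmν hl, chainVar_pot_le_W hν hν' hmν hm,
      chainVar_pot_le_W hμ hμ' hmμ hm]
  refine csSup_le ⟨_, fun _ => 0, LipschitzWith.const' 0 |>.weaken zero_le_one, rfl⟩ ?_
  rintro d ⟨f, hf, rfl⟩
  have hf' : ∀ a b, |f a - f b| ≤ 1 * |a - b| := fun a b => by
    simpa [Real.dist_eq] using hf.dist_le_mul a b
  have hbound : ∀ n : ℕ, |∫ y, interp f (grid n) (gridLen n + 1) y ∂η -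
      ∫ y, interp f (grid n) (gridLen n + 1) y ∂η'| ≤
        W μ μ' + 2 * W ν ν' + e (-(n + 1 : ℝ)) + e (n + 1) := fun n => by
    obtain ⟨l, hl, hsum⟩ := exists_chain_of_monotone (grid_strictMono n).monotone (gridLen n)
    have h1 := hvar hl
    rw [hsum, grid_zero, grid_gridLen] at h1
    refine le_trans ?_ h1
    rw [integral_interp_sub hηM hηM' hmη, abs_neg]
    refine (Finset.abs_sum_le_sum_abs _ _).trans (Finset.sum_le_sum fun i _ => ?_)
    rw [abs_mul]
    refine mul_le_of_le_one_left (abs_nonneg _) ?_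
    have h2 : 0 < grid n (i + 1) - grid n i := sub_pos.2 (grid_strictMono n (Nat.lt_succ_self i))
    rw [abs_div, div_le_one (abs_pos.2 h2.ne')]
    simpa using hf' (grid n (i + 1)) (grid n i)
  have hlim := ((tendsto_integral_interp hηM hf').sub (tendsto_integral_interp hηM' hf')).abs
  have hlim' : Tendsto (fun n : ℕ => W μ μ' + 2 * W ν ν' + e (-(n + 1 : ℝ)) + e (n + 1)) atTop
      (nhds (W μ μ' + 2 * W ν ν' + 0 + 0)) :=
    (tendsto_const_nhds.add (hbot.comp tendsto_neg_nat_add_one_atBot)).add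
      (htop.comp tendsto_nat_add_one_atTop)
  simpa using le_of_tendsto_of_tendsto' hlim hlim' hbound

end
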